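/- For a time-varying FJ model, the following three conditions are equivalent: (1) stability: the system is asymptotically stable, i.e. the matrix product Λ(k)W(k)·Λ(k−1)W(k−1)⋯Λ(0)W(0) tends to the zero matrix as k → ∞; (2) containment: for every x(0), u ∈ ℝⁿ and every i, min_j u_j ≤ liminf_{k→∞} x_i(k) ≤ limsup_{k→∞} x_i(k) ≤ max_j u_j; (3) consensus: if u = u_* 𝟏 for a real number u_*, then x(k) → u_* 𝟏 as k → ∞ for every initial condition x(0). -/

import Mathlib

open Filter

/-- The solution `x(k | x⁰, u)` of the time-varying FJ model
`x(k+1) = Λ(k)W(k)x(k) + (I − Λ(k))u`, `x(0) = x⁰`, with `Λ(k) = diagonal (lam k)`. -/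
noncomputable def sol {n : ℕ} (lam : ℕ → Fin n → ℝ) (W : ℕ → Matrix (Fin n) (Fin n) ℝ)
    (x0 u : Fin n → ℝ) : ℕ → Fin n → ℝ
  | 0 => x0
  | k + 1 => (Matrix.diagonal (lam k) * W k).mulVec (sol lam W x0 u k)
      + (1 - Matrix.diagonal (lam k)).mulVec u

/-- The backward matrix product `Λ(k)W(k)·Λ(k−1)W(k−1)⋯Λ(0)W(0)`. -/
noncomputable def prodA {n : ℕ} (lam : ℕ → Fin n → ℝ)
    (W : ℕ → Matrix (Fin n) (Fin n) ℝ) : ℕ → Matrix (Fin n) (Fin n) ℝ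
  | 0 => Matrix.diagonal (lam 0) * W 0
  | k + 1 => (Matrix.diagonal (lam (k + 1)) * W (k + 1)) * prodA lam W k

/-- One coordinate of the recursion defining `sol`. -/
lemma sol_succ_apply {n : ℕ} (lam : ℕ → Fin n → ℝ) (W : ℕ → Matrix (Fin n) (Fin n) ℝ)
    (x0 u : Fin n → ℝ) (k : ℕ) (i : Fin n) :
    sol lam W x0 u (k + 1) i =
      lam k i * ∑ j, W k i j * sol lam W x0 u k j + (1 - lam k i) * u i := by
  rw [sol, ← Matrix.mulVec_mulVec, Matrix.sub_mulVec, Matrix.one_mulVec]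
  simp only [Pi.add_apply, Pi.sub_apply, Matrix.mulVec_diagonal]
  simp only [Matrix.mulVec, dotProduct]
  ring

lemma sol_mono {n : ℕ} {lam : ℕ → Fin n → ℝ} {W : ℕ → Matrix (Fin n) (Fin n) ℝ}
    (hW0 : ∀ k i j, 0 ≤ W k i j) (hlam : ∀ k i, 0 ≤ lam k i ∧ lam k i ≤ 1)
    {x0 y0 u v : Fin n → ℝ} (hx : x0 ≤ y0) (hu : u ≤ v) (k : ℕ) :
    sol lam W x0 u k ≤ sol lam W y0 v k := by
  induction k with
  | zero => exact hx
  | succ k ih =>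
    intro i
    rw [sol_succ_apply, sol_succ_apply]
    refine add_le_add (mul_le_mul_of_nonneg_left (Finset.sum_le_sum fun j _ => ?_) (hlam k i).1)
      (mul_le_mul_of_nonneg_left (hu i) (sub_nonneg.2 (hlam k i).2))
    exact mul_le_mul_of_nonneg_left (ih j) (hW0 k i j)

lemma sol_const {n : ℕ} (lam : ℕ → Fin n → ℝ) {W : ℕ → Matrix (Fin n) (Fin n) ℝ}
    (hW1 : ∀ k i, ∑ j, W k i j = 1) (c : ℝ) (k : ℕ) :
    sol lam W (fun _ => c) (fun _ => c) k = fun _ => c := by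
  induction k with
  | zero => rfl
  | succ k ih =>
    ext i
    rw [sol_succ_apply, ih, ← Finset.sum_mul, hW1]
    ring

/-- Two solutions with the same prejudices differ by the backward product applied to the
difference of the initial conditions. -/
lemma sol_sub_sol {n : ℕ} (lam : ℕ → Fin n → ℝ) (W : ℕ → Matrix (Fin n) (Fin n) ℝ)
    (x0 y0 u : Fin n → ℝ) (k : ℕ) :
    sol lam W x0 u (k + 1) - sol lam W y0 u (k + 1) = (prodA lam W k).mulVec (x0 - y0) := by
  induction k with
  | zero => simp [sol, prodA, Matrix.mulVec_sub]
  | succ k ih =>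
    rw [prodA, ← Matrix.mulVec_mulVec, ← ih, Matrix.mulVec_sub, sol.eq_2 lam W x0,
      sol.eq_2 lam W y0]
    abel

lemma sol_mem_Icc {n : ℕ} {lam : ℕ → Fin n → ℝ} {W : ℕ → Matrix (Fin n) (Fin n) ℝ}
    (hW0 : ∀ k i j, 0 ≤ W k i j) (hW1 : ∀ k i, ∑ j, W k i j = 1)
    (hlam : ∀ k i, 0 ≤ lam k i ∧ lam k i ≤ 1)
    {x0 u : Fin n → ℝ} {a b : ℝ} (hx : ∀ i, x0 i ∈ Set.Icc a b) (hu : ∀ i, u i ∈ Set.Icc a b)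
    (k : ℕ) (i : Fin n) : sol lam W x0 u k i ∈ Set.Icc a b := by
  constructor
  · have h := sol_mono (y0 := x0) (v := u) hW0 hlam (fun i => (hx i).1) (fun i => (hu i).1) k i
    rwa [sol_const lam hW1] at h
  · have h := sol_mono (x0 := x0) (u := u) hW0 hlam (fun i => (hx i).2) (fun i => (hu i).2) k i
    rwa [sol_const lam hW1] at h

lemma sol_bounded {n : ℕ} {lam : ℕ → Fin n → ℝ} {W : ℕ → Matrix (Fin n) (Fin n) ℝ}
    (hW0 : ∀ k i j, 0 ≤ W k i j) (hW1 : ∀ k i, ∑ j, W k i j = 1)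
    (hlam : ∀ k i, 0 ≤ lam k i ∧ lam k i ≤ 1) (x0 u : Fin n → ℝ) (i : Fin n) :
    IsBoundedUnder (· ≤ ·) atTop (fun k => sol lam W x0 u k i) ∧
      IsBoundedUnder (· ≥ ·) atTop (fun k => sol lam W x0 u k i) := by
  have hbound : ∀ j, |x0 j| ≤ ‖x0‖ + ‖u‖ ∧ |u j| ≤ ‖x0‖ + ‖u‖ := fun j =>
    ⟨(norm_le_pi_norm x0 j).trans (le_add_of_nonneg_right (norm_nonneg u)),
      (norm_le_pi_norm u j).trans (le_add_of_nonneg_left (norm_nonneg x0))⟩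
  have h := fun k => sol_mem_Icc hW0 hW1 hlam (fun j => abs_le.1 (hbound j).1)
    (fun j => abs_le.1 (hbound j).2) k i
  exact ⟨isBoundedUnder_of ⟨_, fun k => (h k).2⟩, isBoundedUnder_of ⟨_, fun k => (h k).1⟩⟩

lemma tendsto_sol_sub_sol {n : ℕ} {lam : ℕ → Fin n → ℝ} {W : ℕ → Matrix (Fin n) (Fin n) ℝ}
    (h : Tendsto (prodA lam W) atTop (nhds 0)) (x0 y0 u : Fin n → ℝ) (i : Fin n) :
    Tendsto (fun k => sol lam W x0 u k i - sol lam W y0 u k i) atTop (nhds 0) := by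
  refine (tendsto_add_atTop_iff_nat 1).1 ?_
  have hc : Continuous fun A : Matrix (Fin n) (Fin n) ℝ => A.mulVec (x0 - y0) i := by
    simp only [Matrix.mulVec, dotProduct]
    fun_prop
  have ht := (hc.tendsto 0).comp h
  simp only [Matrix.zero_mulVec, Pi.zero_apply] at ht
  exact ht.congr fun k => (congrFun (sol_sub_sol lam W x0 y0 u k) i).symm

lemma containment_of_stability {n : ℕ}
    {lam : ℕ → Fin n → ℝ} {W : ℕ → Matrix (Fin n) (Fin n) ℝ}
    (hW0 : ∀ k i j, 0 ≤ W k i j) (hW1 : ∀ k i, ∑ j, W k i j = 1)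
    (hlam : ∀ k i, 0 ≤ lam k i ∧ lam k i ≤ 1) (h : Tendsto (prodA lam W) atTop (nhds 0))
    (x0 u : Fin n → ℝ) (i : Fin n) :
    (⨅ j, u j) ≤ liminf (fun k => sol lam W x0 u k i) atTop ∧
    liminf (fun k => sol lam W x0 u k i) atTop ≤
      limsup (fun k => sol lam W x0 u k i) atTop ∧
    limsup (fun k => sol lam W x0 u k i) atTop ≤ ⨆ j, u j := by
  obtain ⟨hle, hge⟩ := sol_bounded hW0 hW1 hlam x0 u i
  have hu : ∀ j, u j ∈ Set.Icc (⨅ j, u j) (⨆ j, u j) := fun j =>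
    ⟨ciInf_le (Set.finite_range u).bddBelow j, le_ciSup (Set.finite_range u).bddAbove j⟩
  have hmem := fun k => sol_mem_Icc hW0 hW1 hlam hu hu k i
  have hdiff := tendsto_sol_sub_sol h x0 u u i
  refine ⟨?_, liminf_le_limsup hle hge, ?_⟩
  · have ht := hdiff.const_add (⨅ j, u j)
    rw [add_zero] at ht
    rw [← ht.liminf_eq]
    exact liminf_le_liminf (Eventually.of_forall fun k => by linarith [(hmem k).1])
      ht.isBoundedUnder_ge hle.isCoboundedUnder_ge
  · have ht := hdiff.const_add (⨆ j, u j)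
    rw [add_zero] at ht
    rw [← ht.limsup_eq]
    exact limsup_le_limsup (Eventually.of_forall fun k => by linarith [(hmem k).2])
      hge.isCoboundedUnder_le ht.isBoundedUnder_le

lemma stability_of_consensus {n : ℕ}
    {lam : ℕ → Fin n → ℝ} {W : ℕ → Matrix (Fin n) (Fin n) ℝ}
    (hW1 : ∀ k i, ∑ j, W k i j = 1)
    (h : ∀ (c : ℝ) (x0 : Fin n → ℝ),
      Tendsto (fun k => sol lam W x0 (fun _ => c) k) atTop (nhds (fun _ => c))) :
    Tendsto (prodA lam W) atTop (nhds 0) := by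
  refine tendsto_pi_nhds.2 fun i => tendsto_pi_nhds.2 fun j => ?_
  have ht := (tendsto_add_atTop_iff_nat 1).2 (tendsto_pi_nhds.1 (h 0 (Pi.single j 1)) i)
  refine ht.congr fun k => ?_
  have hk := congrFun (sol_sub_sol lam W (Pi.single j 1) (fun _ => 0) (fun _ => 0) k) i
  rw [sol_const lam hW1, show (fun _ : Fin n => (0 : ℝ)) = 0 from rfl, sub_zero, sub_zero,
    Matrix.mulVec_single_one] at hk
  exact hk

/-- Lemma 3: for a time-varying FJ model the following are equivalent:
1) (stability) `Λ(k)W(k)⋯Λ(0)W(0) → 0`;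
2) (containment) for all `x(0), u` and every `i`,
   `min_j u_j ≤ liminf_k x_i(k) ≤ limsup_k x_i(k) ≤ max_j u_j`;
3) (consensus) if `u = u_* 𝟏` then `x(k) → u_* 𝟏` for every `x(0)`. -/
theorem stability_containment_consensus_equiv {n : ℕ} (hn : 0 < n)
    (lam : ℕ → Fin n → ℝ) (W : ℕ → Matrix (Fin n) (Fin n) ℝ)
    (hW0 : ∀ k i j, 0 ≤ W k i j) (hW1 : ∀ k i, ∑ j, W k i j = 1)
    (hlam : ∀ k i, 0 ≤ lam k i ∧ lam k i ≤ 1) :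
    (Tendsto (prodA lam W) atTop (nhds 0) ↔
      (∀ (x0 u : Fin n → ℝ) (i : Fin n),
        (⨅ j, u j) ≤ liminf (fun k => sol lam W x0 u k i) atTop ∧
        liminf (fun k => sol lam W x0 u k i) atTop ≤
          limsup (fun k => sol lam W x0 u k i) atTop ∧
        limsup (fun k => sol lam W x0 u k i) atTop ≤ ⨆ j, u j)) ∧
    ((∀ (x0 u : Fin n → ℝ) (i : Fin n),
        (⨅ j, u j) ≤ liminf (fun k => sol lam W x0 u k i) atTop ∧
        liminf (fun k => sol lam W x0 u k i) atTop ≤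
          limsup (fun k => sol lam W x0 u k i) atTop ∧
        limsup (fun k => sol lam W x0 u k i) atTop ≤ ⨆ j, u j) ↔
      (∀ (u_star : ℝ) (x0 : Fin n → ℝ),
        Tendsto (fun k => sol lam W x0 (fun _ => u_star) k) atTop
          (nhds (fun _ => u_star)))) := by
  have consensus_of_containment : (∀ (x0 u : Fin n → ℝ) (i : Fin n),
        (⨅ j, u j) ≤ liminf (fun k => sol lam W x0 u k i) atTop ∧
        liminf (fun k => sol lam W x0 u k i) atTop ≤
          limsup (fun k => sol lam W x0 u k i) atTop ∧
        limsup (fun k => sol lam W x0 u k i) atTop ≤ ⨆ j, u j) →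
      (∀ (u_star : ℝ) (x0 : Fin n → ℝ),
        Tendsto (fun k => sol lam W x0 (fun _ => u_star) k) atTop
          (nhds (fun _ => u_star))) := by
    intro h c x0
    have : Nonempty (Fin n) := ⟨⟨0, hn⟩⟩
    refine tendsto_pi_nhds.2 fun i => ?_
    obtain ⟨hinf, -, hsup⟩ := h x0 (fun _ => c) i
    rw [ciInf_const] at hinf
    rw [ciSup_const] at hsup
    obtain ⟨hle, hge⟩ := sol_bounded hW0 hW1 hlam x0 (fun _ => c) i
    exact tendsto_of_le_liminf_of_limsup_le hinf hsup hle hge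
  have containment := containment_of_stability hW0 hW1 hlam
  exact ⟨⟨containment, fun h => stability_of_consensus hW1 (consensus_of_containment h)⟩,
    ⟨consensus_of_containment, fun h => containment (stability_of_consensus hW1 h)⟩⟩
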